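/- Let 1 ≤ k ≤ n−1 and p < n−2. Let ∂Ω_t be a smooth strictly convex solution of the flow ∂h/∂t = (h²/f)ρ^{p−n}|Du|^{k+1}σ_{n−k} − η(t)h on [0,T) with uniform two-sided bounds on h, ρ, |∇h|, η(t), |Du|, |D²u| and σ_{n−k} along the flow, with u(·,t) the smooth admissible solution of S_k(D²u)=1 in Ω_t and f positive smooth on S^{n−1}. Then there exists a constant C > 0 independent of t such that the principal curvatures κ_i(·,t) of ∂Ω_t satisfy 1/C ≤ κ_i(·,t) ≤ C for all i = 1,…,n−1 and all t ∈ [0,T). Consequently the matrix (h_{ij}+hδ_{ij})(x,t) satisfies C^{−1}I ≤ (h_{ij}+hδ_{ij})(x,t) ≤ CI on S^{n−1}×[0,T) and the flow equation is uniformly parabolic. -/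

import Mathlib

open MeasureTheory Real Filter Topology Set
open scoped RealInnerProductSpace NNReal ENNReal

noncomputable section

/-- Euclidean space `ℝⁿ`. -/
abbrev En (n : ℕ) := EuclideanSpace ℝ (Fin n)

/-- The unit sphere `S^{n-1}` as a subtype. -/
abbrev Sph (n : ℕ) := Metric.sphere (0 : En n) 1

/-- Spherical Lebesgue measure on `S^{n-1}`. -/
def sphMeasure (n : ℕ) : Measure (Sph n) := (volume : Measure (En n)).toSphere

/-- Support function of a set. -/
def suppFun {n : ℕ} (Ω : Set (En n)) (x : En n) : ℝ :=
  sSup ((fun y => ⟪x, y⟫) '' Ω)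

/-- Radial function of a set (0-homogeneous extension of degree -1). -/
def radialFun {n : ℕ} (Ω : Set (En n)) (v : En n) : ℝ :=
  sSup {c : ℝ | 0 < c ∧ c • v ∈ Ω}

/-- The Hessian matrix of `u : ℝⁿ → ℝ` at `y`. -/
def hessMat {n : ℕ} (u : En n → ℝ) (y : En n) : Matrix (Fin n) (Fin n) ℝ :=
  Matrix.of fun i j =>
    iteratedFDeriv ℝ 2 u y ![EuclideanSpace.single i (1:ℝ), EuclideanSpace.single j (1:ℝ)]

/-- `S_k(A)`: the k-th elementary symmetric function of the eigenvalues of `A`,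
expressed via the characteristic polynomial. -/
def esym (n k : ℕ) (A : Matrix (Fin n) (Fin n) ℝ) : ℝ :=
  (-1 : ℝ) ^ k * (Matrix.charpoly A).coeff (n - k)

/-- Quadratic form of a matrix. -/
def quadForm {n : ℕ} (A : Matrix (Fin n) (Fin n) ℝ) (ξ : En n) : ℝ :=
  ∑ i, ∑ j, A i j * ξ i * ξ j

/-- A convex body in `ℝⁿ` containing the origin in its interior. -/
structure IsConvexBodyO (n : ℕ) (Ω : Set (En n)) : Prop where
  conv : Convex ℝ Ω
  comp : IsCompact Ω
  zeroInt : (0 : En n) ∈ interior Ω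

/-- A smooth, closed, strictly convex hypersurface bounding a convex body that contains
the origin in its interior, encoded via the support function: the support function
(which is the 1-homogeneous extension of its restriction to the sphere) is smooth away
from the origin and its Hessian is positive definite on tangent directions of the sphere. -/
structure IsSmoothStrictlyConvexBody (n : ℕ) (Ω : Set (En n)) : Prop where
  body : IsConvexBodyO n Ω
  suppSmooth : ContDiffOn ℝ (⊤ : ℕ∞) (suppFun Ω) {(0 : En n)}ᶜ
  strictConv : ∀ x : En n, ‖x‖ = 1 → ∀ ξ : En n, ⟪ξ, x⟫ = 0 → ξ ≠ 0 →
    0 < quadForm (hessMat (suppFun Ω) x) ξ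

/-- An admissible (`k`-convex) solution of the `k`-Hessian Dirichlet problem
`S_k(D²u) = 1` in `Ω`, `u = 0` on `∂Ω`. -/
structure IsAdmissibleSolution (n k : ℕ) (Ω : Set (En n)) (u : En n → ℝ) : Prop where
  smooth : ContDiff ℝ (⊤ : ℕ∞) u
  eqn : ∀ y ∈ interior Ω, esym n k (hessMat u y) = 1
  bd : ∀ y ∈ frontier Ω, u y = 0
  kconv : ∀ y ∈ interior Ω, ∀ j, 1 ≤ j → j ≤ k → 0 ≤ esym n j (hessMat u y)

/-- The property of being (a selection of) the radial Gauss map `α_Ω`: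
`α v` is an outer unit normal to `∂Ω` at the boundary point `ρ_Ω(v)v`. -/
def IsRadialGaussMap {n : ℕ} (Ω : Set (En n)) (α : Sph n → Sph n) : Prop :=
  ∀ v : Sph n, ⟪(α v : En n), radialFun Ω (v : En n) • (v : En n)⟫ = suppFun Ω (α v)

/-- The reverse radial Gauss image `α*_Ω(η)`: the set of `v` in the sphere such that
some outer unit normal of `∂Ω` at `ρ_Ω(v)v` belongs to `η`. -/
def revRadialGaussImage {n : ℕ} (Ω : Set (En n)) (η : Set (Sph n)) : Set (Sph n) :=
  {v | ∃ x ∈ η, ⟪(x : En n), radialFun Ω (v : En n) • (v : En n)⟫ = suppFun Ω (x : En n)}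

/-- The integrand `ρ_Ω(v)^{p+1-k} |Du(r_Ω(v))|^{k+1}` of the dual torsional quantities. -/
def QdualIntegrand (n k : ℕ) (p : ℝ) (Ω : Set (En n)) (u : En n → ℝ) (v : Sph n) : ℝ :=
  radialFun Ω (v : En n) ^ (p + 1 - (k : ℝ)) *
    ‖gradient u (radialFun Ω (v : En n) • (v : En n))‖ ^ (k + 1)

/-- The `p`-th dual `k`-torsional measure as a set function:
`Q̃_{k,n-p}(Ω,η) = (1/(n-p)) ∫_{α*_Ω(η)} ρ_Ω^{p+1-k} |Du(r_Ω(v))|^{k+1} dv`. -/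
def QdualSet (n k : ℕ) (p : ℝ) (Ω : Set (En n)) (u : En n → ℝ) (η : Set (Sph n)) : ℝ :=
  ((n : ℝ) - p)⁻¹ *
    ∫ v in revRadialGaussImage Ω η, QdualIntegrand n k p Ω u v ∂(sphMeasure n)

/-- The `p`-th dual `k`-torsional rigidity
`Q̃_{k,n-p}(Ω) = (1/(n-p)) ∫_{S^{n-1}} ρ_Ω^{p+1-k} |Du(r_Ω(v))|^{k+1} dv`. -/
def Qdual (n k : ℕ) (p : ℝ) (Ω : Set (En n)) (u : En n → ℝ) : ℝ :=
  ((n : ℝ) - p)⁻¹ * ∫ v, QdualIntegrand n k p Ω u v ∂(sphMeasure n)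

/-- The normalized `k`-torsional rigidity
`T̃_k(Ω) = (1/(k(n+2))) ∫_{S^{n-1}} ρ_Ω^{n+1-k} |Du(r_Ω(v))|^{k+1} dv`. -/
def Ttil (n k : ℕ) (Ω : Set (En n)) (u : En n → ℝ) : ℝ :=
  (1 / ((k : ℝ) * ((n : ℝ) + 2))) *
    ∫ v : Sph n, radialFun Ω (v : En n) ^ ((n : ℝ) + 1 - (k : ℝ)) *
      ‖gradient u (radialFun Ω (v : En n) • (v : En n))‖ ^ (k + 1) ∂(sphMeasure n)

/-- The normalization factor `η(t)` in the flow. -/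
def etaFn (n k : ℕ) (p : ℝ) (Ω : ℝ → Set (En n)) (u : ℝ → En n → ℝ) (f : En n → ℝ)
    (t : ℝ) : ℝ :=
  (∫ v, QdualIntegrand n k p (Ω t) (u t) v ∂(sphMeasure n)) /
    (∫ x : Sph n, f (x : En n) ∂(sphMeasure n))

/-- The scalar form of the flow equation (4.1)/(1.7):
`∂h/∂t = (h²/f)(|∇h|²+h²)^{(p-n)/2} |Du(∇̄h,t)|^{k+1} σ_{n-k} - η(t) h`,
written via the 1-homogeneous extension `H = suppFun (Ω t)` of the support function,
for which `∇̄h = gradient H`, `|∇h|²+h² = ‖gradient H‖²` and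
`σ_{n-k}(h_{ij}+hδ_{ij}) = S_{n-k}(D²H)`. -/
def SatisfiesFlow (n k : ℕ) (p : ℝ) (I : Set ℝ) (Ω : ℝ → Set (En n))
    (u : ℝ → En n → ℝ) (f : En n → ℝ) : Prop :=
  ∀ t ∈ I, ∀ x : En n, ‖x‖ = 1 →
    HasDerivAt (fun s => suppFun (Ω s) x)
      ((suppFun (Ω t) x) ^ 2 / f x * ‖gradient (suppFun (Ω t)) x‖ ^ (p - (n : ℝ)) *
          ‖gradient (u t) (gradient (suppFun (Ω t)) x)‖ ^ (k + 1) *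
          esym n (n - k) (hessMat (suppFun (Ω t)) x)
        - etaFn n k p Ω u f t * suppFun (Ω t) x) t

/-- Bundled hypotheses: a smooth strictly convex solution of the flow on `I`,
together with the admissible solutions of the `k`-Hessian equation on each `Ω_t`. -/
structure IsFlowSolution (n k : ℕ) (p : ℝ) (I : Set ℝ) (Ω : ℝ → Set (En n))
    (u : ℝ → En n → ℝ) (f : En n → ℝ) : Prop where
  bodies : ∀ t ∈ I, IsSmoothStrictlyConvexBody n (Ω t)
  adm : ∀ t ∈ I, IsAdmissibleSolution n k (Ω t) (u t)
  flow : SatisfiesFlow n k p I Ω u f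

end

theorem quadForm_eq_inner {n : ℕ} (A : Matrix (Fin n) (Fin n) ℝ) (ξ : En n) :
    quadForm A ξ = ⟪Matrix.toEuclideanLin A ξ, ξ⟫ := by
  simp only [quadForm, PiLp.inner_apply, Matrix.toLpLin_apply, Matrix.mulVec, dotProduct,
    RCLike.inner_apply, conj_trivial, Finset.mul_sum]
  refine Finset.sum_congr rfl fun i _ => Finset.sum_congr rfl fun j _ => ?_
  ring

/-- `esym` of a symmetric matrix is the elementary symmetric polynomial of its eigenvalues. -/
theorem esym_eq_sum_prod_eigenvalues {n m : ℕ} {A : Matrix (Fin n) (Fin n) ℝ}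
    (hA : A.IsHermitian) (hm : m ≤ n) :
    esym n m A = ∑ s ∈ Finset.powersetCard m Finset.univ, ∏ i ∈ s, hA.eigenvalues i := by
  have h := Multiset.prod_X_sub_C_coeff (Finset.univ.val.map hA.eigenvalues) (k := n - m)
    (by simp)
  have hc : A.charpoly =
      ((Finset.univ.val.map hA.eigenvalues).map fun t => Polynomial.X - Polynomial.C t).prod := by
    rw [hA.charpoly_eq, Multiset.map_map]
    rfl
  rw [esym, hc, h, Finset.esymm_map_val]
  simp only [Multiset.card_map, Finset.card_val, Finset.card_univ, Fintype.card_fin,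
    Nat.sub_sub_self hm]
  rw [← mul_assoc, ← mul_pow]
  simp

/-- If a symmetric matrix has a one-dimensional kernel `ℝ x`, is positive definite on `x^⊥`, and
satisfies `a A ≤ A²`, then on `x^⊥` it is bounded below by `a` and above in terms of any of its
elementary symmetric functions of order `1 ≤ m ≤ n - 1`. -/
theorem quadForm_bounds_of_le_sq {n m : ℕ} {A : Matrix (Fin n) (Fin n) ℝ} (hA : A.IsHermitian)
    {x : En n} (hx : ‖x‖ = 1) (hAx : Matrix.toEuclideanLin A x = 0)
    (hpos : ∀ ξ : En n, ⟪ξ, x⟫ = 0 → ξ ≠ 0 → 0 < quadForm A ξ)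
    {a : ℝ} (ha : 0 < a) (hsq : ∀ ξ : En n, a * quadForm A ξ ≤ ‖Matrix.toEuclideanLin A ξ‖ ^ 2)
    (hm1 : 1 ≤ m) (hmn : m ≤ n - 1) {B : ℝ} (hB : esym n m A ≤ B) {ξ : En n} (hξ : ⟪ξ, x⟫ = 0) :
    a * ‖ξ‖ ^ 2 ≤ quadForm A ξ ∧ quadForm A ξ ≤ B / a ^ (m - 1) * ‖ξ‖ ^ 2 := by
  set W := Matrix.toEuclideanLin A with hW
  have hsymm : W.IsSymmetric := Matrix.isSymmetric_toEuclideanLin_iff.mpr hA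
  set b := hA.eigenvectorBasis
  set l := hA.eigenvalues
  have hWb : ∀ i, W (b i) = l i • b i := by
    intro i
    have := hA.mulVec_eigenvectorBasis i
    ext j
    have h2 := congrFun this j
    simpa [hW, Matrix.toLpLin_apply] using h2
  have hnorm : ∀ i, ‖b i‖ = 1 := fun i => b.orthonormal.1 i
  have hqb : ∀ i, quadForm A (b i) = l i := by
    intro i
    rw [quadForm_eq_inner, ← hW, hWb, real_inner_smul_left, real_inner_self_eq_norm_sq, hnorm]
    ring
  have hlx : ∀ i, l i * ⟪b i, x⟫ = 0 := by
    intro i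
    rw [← real_inner_smul_left, ← hWb, hsymm, hAx, inner_zero_right]
  have hlow : ∀ i, l i ≠ 0 → a ≤ l i := by
    intro i hi
    have hbx : ⟪b i, x⟫ = 0 := (mul_eq_zero.mp (hlx i)).resolve_left hi
    have hlpos : 0 < l i := by
      rw [← hqb]
      exact hpos _ hbx (by rw [← norm_ne_zero_iff, hnorm]; exact one_ne_zero)
    have h := hsq (b i)
    rw [hqb, hWb, norm_smul, hnorm, mul_one, Real.norm_eq_abs, sq_abs, sq] at h
    exact le_of_mul_le_mul_right h hlpos
  have hker : ∀ i, l i = 0 → b i = ⟪b i, x⟫ • x := by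
    intro i hi
    by_contra hne
    have h := hpos (b i - ⟪b i, x⟫ • x)
      (by rw [inner_sub_left, real_inner_smul_left, real_inner_self_eq_norm_sq, hx]; ring)
      (sub_ne_zero.mpr hne)
    rw [quadForm_eq_inner, ← hW, map_sub, map_smul, hAx, hWb, hi] at h
    simp at h
  have hone : ∀ i j, l i = 0 → l j = 0 → i = j := by
    intro i j hi hj
    by_contra hij
    have h : ⟪b i, b j⟫ = 0 := b.orthonormal.2 hij
    rw [hker i hi, hker j hj, real_inner_smul_left, real_inner_smul_right,
      real_inner_self_eq_norm_sq, hx] at h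
    rcases mul_eq_zero.mp h with h0 | h0
    · have h1 := hker i hi
      rw [h0, zero_smul] at h1
      simpa [h1] using hnorm i
    · have h1 := hker j hj
      rw [one_pow, mul_one] at h0
      rw [h0, zero_smul] at h1
      simpa [h1] using hnorm j
  have hl0 : ∀ i, 0 ≤ l i := fun i => by
    by_cases hi : l i = 0
    · exact hi.ge
    · exact ha.le.trans (hlow i hi)
  have hup : ∀ i, l i ≠ 0 → l i ≤ B / a ^ (m - 1) := by
    intro i hi
    have hcard : m ≤ (Finset.univ.filter fun j => l j ≠ 0).card := by
      have h1 : (Finset.univ.filter fun j => l j = 0).card ≤ 1 :=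
        Finset.card_le_one.mpr fun p hp q hq =>
          hone p q (Finset.mem_filter.mp hp).2 (Finset.mem_filter.mp hq).2
      have h2 := Finset.card_filter_add_card_filter_not (s := (Finset.univ : Finset (Fin n)))
        (fun j => l j = 0)
      rw [Finset.card_univ, Fintype.card_fin] at h2
      simp only [ne_eq]
      omega
    obtain ⟨s, his, hsl, hs⟩ := Finset.exists_subsuperset_card_eq
      (s := {i}) (t := Finset.univ.filter fun j => l j ≠ 0) (by simpa using hi) (by simpa using hm1)
      hcard
    have hi_s : i ∈ s := his (Finset.mem_singleton_self i)
    rw [le_div_iff₀ (pow_pos ha _)]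
    refine le_trans ?_ hB
    rw [esym_eq_sum_prod_eigenvalues hA (by omega)]
    calc l i * a ^ (m - 1) ≤ l i * ∏ j ∈ s.erase i, l j := by
          refine mul_le_mul_of_nonneg_left ?_ (hl0 i)
          rw [← hs, ← Finset.card_erase_of_mem hi_s, ← Finset.prod_const]
          exact Finset.prod_le_prod (fun _ _ => ha.le) fun j hj =>
            hlow j (Finset.mem_filter.mp (hsl (Finset.mem_of_mem_erase hj))).2
      _ = ∏ j ∈ s, l j := Finset.mul_prod_erase s l hi_s
      _ ≤ _ := Finset.single_le_sum (f := fun s : Finset (Fin n) => ∏ j ∈ s, l j)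
          (fun _ _ => Finset.prod_nonneg fun j _ => hl0 j)
          (Finset.mem_powersetCard.mpr ⟨Finset.subset_univ s, hs⟩)
  have hq : quadForm A ξ = ∑ i, l i * ⟪b i, ξ⟫ ^ 2 := by
    rw [quadForm_eq_inner, ← hW, ← b.sum_inner_mul_inner (W ξ) ξ]
    refine Finset.sum_congr rfl fun i _ => ?_
    rw [hsymm, hWb, real_inner_smul_right, real_inner_comm]
    ring
  have hn : ‖ξ‖ ^ 2 = ∑ i, ⟪b i, ξ⟫ ^ 2 := by
    rw [← real_inner_self_eq_norm_sq, ← b.sum_inner_mul_inner ξ ξ]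
    refine Finset.sum_congr rfl fun i _ => ?_
    rw [real_inner_comm]
    ring
  have hzero : ∀ i, l i = 0 → ⟪b i, ξ⟫ = 0 := by
    intro i hi
    rw [hker i hi, real_inner_smul_left, real_inner_comm ξ, hξ, mul_zero]
  rw [hq, hn, Finset.mul_sum, Finset.mul_sum]
  constructor <;> refine Finset.sum_le_sum fun i _ => ?_ <;> by_cases hi : l i = 0
  · simp [hzero i hi]
  · exact mul_le_mul_of_nonneg_right (hlow i hi) (sq_nonneg _)
  · simp [hzero i hi]
  · exact mul_le_mul_of_nonneg_right (hup i hi) (sq_nonneg _)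

/-- The derivative of the gradient represents the second derivative. -/
theorem exists_hasFDerivAt_gradient {n : ℕ} {φ : En n → ℝ} {x : En n} (hφ : ContDiffAt ℝ 2 φ x) :
    ∃ W : En n →L[ℝ] En n, HasFDerivAt (gradient φ) W x ∧
      ∀ v w, ⟪W v, w⟫ = iteratedFDeriv ℝ 2 φ x ![v, w] := by
  have hd : DifferentiableAt ℝ (fderiv ℝ φ) x :=
    (hφ.fderiv_right (m := 1) le_rfl).differentiableAt one_ne_zero
  let L : (En n →L[ℝ] ℝ) →L[ℝ] En n := LinearMap.toContinuousLinearMap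
    { toFun := (InnerProductSpace.toDual ℝ (En n)).symm
      map_add' := map_add _
      map_smul' := fun c v => by simp }
  refine ⟨L.comp (fderiv ℝ (fderiv ℝ φ) x), L.hasFDerivAt.comp x hd.hasFDerivAt, fun v w => ?_⟩
  rw [iteratedFDeriv_two_apply]
  exact InnerProductSpace.toDual_symm_apply

theorem toEuclideanLin_hessMat {n : ℕ} {φ : En n → ℝ} {x : En n} {W : En n →L[ℝ] En n}
    (hW : ∀ v w, ⟪W v, w⟫ = iteratedFDeriv ℝ 2 φ x ![v, w]) (hA : (hessMat φ x).IsHermitian) :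
    Matrix.toEuclideanLin (hessMat φ x) = (W : En n →ₗ[ℝ] En n) := by
  refine (EuclideanSpace.basisFun (Fin n) ℝ).toBasis.ext fun j => ?_
  ext i
  have h := hW (EuclideanSpace.single j 1) (EuclideanSpace.single i 1)
  rw [EuclideanSpace.inner_single_right] at h
  have h2 := hA.apply j i
  simp [hessMat] at h h2 ⊢
  rw [h2, h]

theorem isHermitian_hessMat {n : ℕ} {φ : En n → ℝ} {x : En n} (hφ : ContDiffAt ℝ 2 φ x) :
    (hessMat φ x).IsHermitian := by
  ext i j
  simpa [hessMat, iteratedFDeriv_two_apply] using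
    (hφ.isSymmSndFDerivAt (by simp)).eq (EuclideanSpace.single j 1) (EuclideanSpace.single i 1)

section SupportFunction

variable {n : ℕ} {Ω : Set (En n)}

theorem inner_le_suppFun (hΩ : IsCompact Ω) (x : En n) {y : En n} (hy : y ∈ Ω) :
    ⟪x, y⟫ ≤ suppFun Ω x :=
  le_csSup (hΩ.image (by fun_prop : Continuous fun y : En n => ⟪x, y⟫)).bddAbove
    (Set.mem_image_of_mem _ hy)

/-- A support point with normal `x` is the gradient of the support function at `x`. -/
theorem gradient_suppFun_eq (hΩ : IsCompact Ω) {x y : En n}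
    (hd : DifferentiableAt ℝ (suppFun Ω) x) (hy : y ∈ Ω) (hyx : ⟪x, y⟫ = suppFun Ω x) :
    gradient (suppFun Ω) x = y := by
  have hmin : IsLocalMin (fun z => suppFun Ω z - ⟪y, z⟫) x := by
    refine Filter.Eventually.of_forall fun z => ?_
    have := inner_le_suppFun hΩ z hy
    simp only [← hyx, real_inner_comm y] at *
    linarith
  have h0 := hmin.hasFDerivAt_eq_zero
    (hd.hasGradientAt.hasFDerivAt.sub (InnerProductSpace.toDual ℝ (En n) y).hasFDerivAt)
  exact (InnerProductSpace.toDual ℝ (En n)).injective (sub_eq_zero.mp h0)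

theorem gradient_suppFun_mem (hΩ : IsCompact Ω) (hne : Ω.Nonempty) {x : En n}
    (hd : DifferentiableAt ℝ (suppFun Ω) x) :
    gradient (suppFun Ω) x ∈ Ω ∧ ⟪x, gradient (suppFun Ω) x⟫ = suppFun Ω x := by
  obtain ⟨y, hy, hyx⟩ := hΩ.exists_sSup_image_eq hne
    (by fun_prop : Continuous fun y : En n => ⟪x, y⟫).continuousOn
  rw [gradient_suppFun_eq hΩ hd hy hyx.symm]
  exact ⟨hy, hyx.symm⟩

theorem gradient_suppFun_mem_frontier (hΩ : IsCompact Ω) (hne : Ω.Nonempty) {x : En n}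
    (hx : x ≠ 0) (hd : DifferentiableAt ℝ (suppFun Ω) x) :
    gradient (suppFun Ω) x ∈ frontier Ω := by
  obtain ⟨hy, hyx⟩ := gradient_suppFun_mem hΩ hne hd
  rw [hΩ.isClosed.frontier_eq]
  refine ⟨hy, fun hint => ?_⟩
  have hmax : IsLocalMax (fun y => ⟪x, y⟫) (gradient (suppFun Ω) x) := by
    filter_upwards [mem_interior_iff_mem_nhds.mp hint] with z hz
    rw [hyx]
    exact inner_le_suppFun hΩ x hz
  have h0 := hmax.hasFDerivAt_eq_zero (InnerProductSpace.toDual ℝ (En n) x).hasFDerivAt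
  exact hx ((InnerProductSpace.toDual ℝ (En n)).map_eq_zero_iff.mp h0)

/-- The derivative of the inverse Gauss map takes values in the tangent space. -/
theorem inner_fderiv_gradient_suppFun (hΩ : IsCompact Ω) (hne : Ω.Nonempty) {x : En n}
    (hd : ∀ᶠ z in 𝓝 x, DifferentiableAt ℝ (suppFun Ω) z) {W : En n →L[ℝ] En n}
    (hW : HasFDerivAt (gradient (suppFun Ω)) W x) (ξ : En n) : ⟪W ξ, x⟫ = 0 := by
  have hmax : IsLocalMax (fun z => ⟪x, gradient (suppFun Ω) z⟫) x := by
    filter_upwards [hd] with z hz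
    rw [(gradient_suppFun_mem hΩ hne hd.self_of_nhds).2]
    exact inner_le_suppFun hΩ x (gradient_suppFun_mem hΩ hne hz).1
  have h0 := hmax.hasFDerivAt_eq_zero
    ((InnerProductSpace.toDual ℝ (En n) x).hasFDerivAt.comp x hW)
  rw [real_inner_comm]
  exact congrArg (fun L : En n →L[ℝ] ℝ => L ξ) h0

theorem suppFun_smul (Ω : Set (En n)) {c : ℝ} (hc : 0 ≤ c) (x : En n) :
    suppFun Ω (c • x) = c * suppFun Ω x := by
  rw [suppFun, suppFun, ← smul_eq_mul, ← Real.sSup_smul_of_nonneg hc, ← Set.image_smul,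
    Set.image_image]
  simp only [real_inner_smul_left, smul_eq_mul]

/-- The gradient of the support function is `0`-homogeneous. -/
theorem gradient_suppFun_smul (hΩ : IsCompact Ω) (hne : Ω.Nonempty) {c : ℝ} (hc : 0 ≤ c)
    {x : En n} (hd : DifferentiableAt ℝ (suppFun Ω) x)
    (hd' : DifferentiableAt ℝ (suppFun Ω) (c • x)) :
    gradient (suppFun Ω) (c • x) = gradient (suppFun Ω) x := by
  obtain ⟨hy, hyx⟩ := gradient_suppFun_mem hΩ hne hd
  refine gradient_suppFun_eq hΩ hd' hy ?_
  rw [real_inner_smul_left, hyx, suppFun_smul Ω hc]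

end SupportFunction

section StrictlyConvexBody

variable {n : ℕ} {Ω : Set (En n)}

theorem IsSmoothStrictlyConvexBody.contDiffAt (hΩ : IsSmoothStrictlyConvexBody n Ω) {x : En n}
    (hx : x ≠ 0) : ContDiffAt ℝ 2 (suppFun Ω) x :=
  ((hΩ.suppSmooth x hx).contDiffAt (isOpen_compl_singleton.mem_nhds hx)).of_le
    (WithTop.coe_le_coe.mpr (le_top : (2 : ℕ∞) ≤ ⊤))

theorem IsSmoothStrictlyConvexBody.nonempty (hΩ : IsSmoothStrictlyConvexBody n Ω) :
    Ω.Nonempty :=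
  ⟨0, interior_subset hΩ.body.zeroInt⟩

theorem IsSmoothStrictlyConvexBody.differentiableAt (hΩ : IsSmoothStrictlyConvexBody n Ω)
    {x : En n} (hx : x ≠ 0) : DifferentiableAt ℝ (suppFun Ω) x :=
  (hΩ.contDiffAt hx).differentiableAt two_ne_zero

theorem IsSmoothStrictlyConvexBody.gradient_mem_frontier (hΩ : IsSmoothStrictlyConvexBody n Ω)
    {x : En n} (hx : x ≠ 0) : gradient (suppFun Ω) x ∈ frontier Ω :=
  gradient_suppFun_mem_frontier hΩ.body.comp hΩ.nonempty hx (hΩ.differentiableAt hx)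

/-- The Hessian of the support function annihilates the normal direction. -/
theorem IsSmoothStrictlyConvexBody.toEuclideanLin_hessMat_self
    (hΩ : IsSmoothStrictlyConvexBody n Ω) {x : En n} (hx : x ≠ 0) :
    Matrix.toEuclideanLin (hessMat (suppFun Ω) x) x = 0 := by
  have hA := isHermitian_hessMat (hΩ.contDiffAt hx)
  obtain ⟨W, hW, hWi⟩ := exists_hasFDerivAt_gradient (hΩ.contDiffAt hx)
  have hev : ∀ᶠ z in 𝓝 x, DifferentiableAt ℝ (suppFun Ω) z :=
    (eventually_ne_nhds hx).mono fun z hz => hΩ.differentiableAt hz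
  refine ext_inner_right ℝ fun v => ?_
  rw [(Matrix.isSymmetric_toEuclideanLin_iff.mpr hA) x v, toEuclideanLin_hessMat hWi hA,
    inner_zero_left, real_inner_comm]
  exact inner_fderiv_gradient_suppFun hΩ.body.comp hΩ.nonempty hev hW v

/-- If `u` vanishes on `∂Ω`, then `Du` is normal to `∂Ω`. -/
theorem IsSmoothStrictlyConvexBody.gradient_eq_smul_of_norm_eq_one
    (hΩ : IsSmoothStrictlyConvexBody n Ω) {u : En n → ℝ} (hu : Differentiable ℝ u)
    (hbd : ∀ y ∈ frontier Ω, u y = 0) {x : En n} (hx : ‖x‖ = 1) :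
    gradient u (gradient (suppFun Ω) x) =
      ⟪gradient u (gradient (suppFun Ω) x), x⟫ • x := by
  have hx0 : x ≠ 0 := norm_ne_zero_iff.mp (hx ▸ one_ne_zero)
  have hA := isHermitian_hessMat (hΩ.contDiffAt hx0)
  obtain ⟨W, hW, hWi⟩ := exists_hasFDerivAt_gradient (hΩ.contDiffAt hx0)
  have hWA := toEuclideanLin_hessMat hWi hA
  have hsymm := Matrix.isSymmetric_toEuclideanLin_iff.mpr hA
  have hAx := hΩ.toEuclideanLin_hessMat_self hx0
  set A := hessMat (suppFun Ω) x
  set y := gradient (suppFun Ω) x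
  have hzero : ∀ v, ⟪gradient u y, W v⟫ = 0 := by
    have hconst : (fun z => u (gradient (suppFun Ω) z)) =ᶠ[𝓝 x] fun _ => 0 :=
      (eventually_ne_nhds hx0).mono fun z hz => hbd _ (hΩ.gradient_mem_frontier hz)
    have h := ((hu y).hasGradientAt.hasFDerivAt.comp x hW).unique
      ((hasFDerivAt_const (0 : ℝ) x).congr_of_eventuallyEq hconst)
    exact fun v => congrArg (fun L : En n →L[ℝ] ℝ => L v) h
  by_contra hne
  have hpos := hΩ.strictConv x hx (gradient u y - ⟪gradient u y, x⟫ • x)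
    (by rw [inner_sub_left, real_inner_smul_left, real_inner_self_eq_norm_sq, hx]; ring)
    (sub_ne_zero.mpr hne)
  rw [quadForm_eq_inner, inner_sub_right, real_inner_smul_right, hsymm _ x, hAx,
    inner_zero_right, hWA, real_inner_comm] at hpos
  simp [-map_sub, -map_smul, hzero] at hpos

theorem IsSmoothStrictlyConvexBody.gradient_eq_smul
    (hΩ : IsSmoothStrictlyConvexBody n Ω) {u : En n → ℝ} (hu : Differentiable ℝ u)
    (hbd : ∀ y ∈ frontier Ω, u y = 0) {x : En n} (hx : x ≠ 0) :
    gradient u (gradient (suppFun Ω) x) =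
      (⟪gradient u (gradient (suppFun Ω) x), x⟫ / ‖x‖ ^ 2) • x := by
  have hn : ‖x‖ ≠ 0 := norm_ne_zero_iff.mpr hx
  have hx1 : ‖‖x‖⁻¹ • x‖ = 1 := norm_smul_inv_norm hx
  have hx1' : ‖x‖⁻¹ • x ≠ 0 := norm_ne_zero_iff.mp (hx1 ▸ one_ne_zero)
  have h := hΩ.gradient_eq_smul_of_norm_eq_one hu hbd hx1
  rw [gradient_suppFun_smul hΩ.body.comp hΩ.nonempty (by positivity) (hΩ.differentiableAt hx)
    (hΩ.differentiableAt hx1'), smul_smul, real_inner_smul_right] at h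
  convert h using 2
  field_simp

/-- Differentiating the Dirichlet condition twice along `∂Ω`: with `W` the derivative of the
inverse Gauss map, `D²u(Wξ, Wξ) = ⟨Du, x⟩ ⟨Wξ, ξ⟩`. -/
theorem IsSmoothStrictlyConvexBody.hessian_eq_inner_mul_quadForm
    (hΩ : IsSmoothStrictlyConvexBody n Ω) {u : En n → ℝ} (hu : ContDiff ℝ 2 u)
    (hbd : ∀ y ∈ frontier Ω, u y = 0) {x : En n} (hx : ‖x‖ = 1) (ξ : En n) :
    iteratedFDeriv ℝ 2 u (gradient (suppFun Ω) x)
        ![Matrix.toEuclideanLin (hessMat (suppFun Ω) x) ξ,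
          Matrix.toEuclideanLin (hessMat (suppFun Ω) x) ξ] =
      ⟪gradient u (gradient (suppFun Ω) x), x⟫ * quadForm (hessMat (suppFun Ω) x) ξ := by
  have hx0 : x ≠ 0 := norm_ne_zero_iff.mp (hx ▸ one_ne_zero)
  have hA := isHermitian_hessMat (hΩ.contDiffAt hx0)
  obtain ⟨W, hW, hWi⟩ := exists_hasFDerivAt_gradient (hΩ.contDiffAt hx0)
  have hsymm := Matrix.isSymmetric_toEuclideanLin_iff.mpr hA
  have hAx := hΩ.toEuclideanLin_hessMat_self hx0
  obtain ⟨V, hV, hVi⟩ := exists_hasFDerivAt_gradient (hu.contDiffAt (x := gradient (suppFun Ω) x))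
  have hWx : ⟪x, W ξ⟫ = 0 := by
    have h := hsymm x ξ
    rw [hAx, inner_zero_left, toEuclideanLin_hessMat hWi hA] at h
    exact h.symm
  rw [quadForm_eq_inner, toEuclideanLin_hessMat hWi hA]
  simp only [ContinuousLinearMap.coe_coe]
  rw [← hVi]
  set g : En n → En n := fun z => gradient u (gradient (suppFun Ω) z)
  have hg : HasFDerivAt g (V.comp W) x := hV.comp x hW
  have hgd : DifferentiableAt ℝ (fun z => ⟪g z, z⟫ / ‖z‖ ^ 2) x := by
    simp only [div_eq_mul_inv]
    exact (hg.differentiableAt.inner ℝ differentiableAt_fun_id).fun_mul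
      ((differentiableAt_fun_id.norm_sq ℝ).fun_inv (by simp [hx]))
  have hrhs := hgd.hasFDerivAt.smul (hasFDerivAt_id x)
  have heq : g =ᶠ[𝓝 x] fun z => (⟪g z, z⟫ / ‖z‖ ^ 2) • id z :=
    (eventually_ne_nhds hx0).mono fun z hz =>
      hΩ.gradient_eq_smul (hu.differentiable two_ne_zero) hbd hz
  have h := congrArg (fun L : En n →L[ℝ] En n => ⟪L ξ, W ξ⟫)
    (hg.unique (hrhs.congr_of_eventuallyEq heq))
  simp [inner_add_left, real_inner_smul_left, hWx, hx] at h
  rw [h, real_inner_comm ξ]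

/-- If `u` vanishes on `∂Ω`, `|D²u| ≤ K` and `|Du| ≥ c` on `∂Ω`, then the matrix `W` of principal
radii satisfies `c W ≤ K W²`. -/
theorem IsSmoothStrictlyConvexBody.mul_quadForm_le_norm_sq
    (hΩ : IsSmoothStrictlyConvexBody n Ω) {u : En n → ℝ} (hu : ContDiff ℝ 2 u)
    (hbd : ∀ y ∈ frontier Ω, u y = 0) {x : En n} (hx : ‖x‖ = 1) {c K : ℝ}
    (hc : c ≤ ‖gradient u (gradient (suppFun Ω) x)‖)
    (hK : ‖iteratedFDeriv ℝ 2 u (gradient (suppFun Ω) x)‖ ≤ K) (ξ : En n) :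
    c * quadForm (hessMat (suppFun Ω) x) ξ ≤
      K * ‖Matrix.toEuclideanLin (hessMat (suppFun Ω) x) ξ‖ ^ 2 := by
  have hx0 : x ≠ 0 := norm_ne_zero_iff.mp (hx ▸ one_ne_zero)
  have hnonneg : 0 ≤ quadForm (hessMat (suppFun Ω) x) ξ := by
    have hsymm := Matrix.isSymmetric_toEuclideanLin_iff.mpr
      (isHermitian_hessMat (hΩ.contDiffAt hx0))
    have hAx := hΩ.toEuclideanLin_hessMat_self hx0
    have h : quadForm (hessMat (suppFun Ω) x) ξ =
        quadForm (hessMat (suppFun Ω) x) (ξ - ⟪ξ, x⟫ • x) := by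
      rw [quadForm_eq_inner, quadForm_eq_inner, map_sub, map_smul, hAx, smul_zero, sub_zero,
        inner_sub_right, real_inner_smul_right, hsymm ξ x, hAx, inner_zero_right, mul_zero,
        sub_zero]
    rw [h]
    by_cases h0 : ξ - ⟪ξ, x⟫ • x = 0
    · simp [h0, quadForm]
    · exact (hΩ.strictConv x hx _ (by
        rw [inner_sub_left, real_inner_smul_left, real_inner_self_eq_norm_sq, hx]; ring) h0).le
  have hnorm : ‖gradient u (gradient (suppFun Ω) x)‖ =
      |⟪gradient u (gradient (suppFun Ω) x), x⟫| := by
    conv_lhs => rw [hΩ.gradient_eq_smul_of_norm_eq_one (hu.differentiable two_ne_zero) hbd hx]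
    rw [norm_smul, hx, mul_one, Real.norm_eq_abs]
  calc c * quadForm (hessMat (suppFun Ω) x) ξ
      ≤ |⟪gradient u (gradient (suppFun Ω) x), x⟫| * quadForm (hessMat (suppFun Ω) x) ξ :=
        mul_le_mul_of_nonneg_right (hnorm ▸ hc) hnonneg
    _ = ‖iteratedFDeriv ℝ 2 u (gradient (suppFun Ω) x)
          ![Matrix.toEuclideanLin (hessMat (suppFun Ω) x) ξ,
            Matrix.toEuclideanLin (hessMat (suppFun Ω) x) ξ]‖ := by
        rw [hΩ.hessian_eq_inner_mul_quadForm hu hbd hx, norm_mul, Real.norm_eq_abs,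
          Real.norm_of_nonneg hnonneg]
    _ ≤ _ := by
        refine (ContinuousMultilinearMap.le_of_opNorm_le hK _).trans_eq ?_
        simp [Fin.prod_univ_two, sq]

end StrictlyConvexBody

/-- **C² estimate: principal curvature bounds (Lemma 5.7).** For `p < n-2`, along a
smooth strictly convex solution of the flow with uniform two-sided bounds on `h`, `ρ`,
`|∇h|`, `η(t)`, `|Du|`, `|D²u|` and `σ_{n-k}`, the principal curvatures of `∂Ω_t`
satisfy `1/C ≤ κ_i ≤ C`; equivalently, the matrix `ω = (h_{ij}+hδ_{ij})` of principal
curvature radii satisfies `C⁻¹ I ≤ ω ≤ C I` as quadratic forms on the tangent space of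
the sphere (here expressed via the Hessian of the 1-homogeneous extension of the
support function acting on vectors `ξ ⟂ x`), so the flow equation is uniformly
parabolic. -/
theorem principal_curvature_bounds_along_flow (n k : ℕ) (p T C₀ : ℝ) (hk1 : 1 ≤ k)
    (hkn : k ≤ n - 1) (hp : p < (n : ℝ) - 2) (hC₀ : 0 < C₀)
    (Ω : ℝ → Set (En n)) (u : ℝ → En n → ℝ) (f : En n → ℝ)
    (hfpos : ∀ x : En n, ‖x‖ = 1 → 0 < f x)
    (hfsm : ContDiffOn ℝ (⊤ : ℕ∞) f {(0 : En n)}ᶜ)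
    (hflow : IsFlowSolution n k p (Set.Ico 0 T) Ω u f)
    (hbnd : ∀ t ∈ Set.Ico (0 : ℝ) T, ∀ x : En n, ‖x‖ = 1 →
      (1 / C₀ ≤ suppFun (Ω t) x ∧ suppFun (Ω t) x ≤ C₀) ∧
      (1 / C₀ ≤ radialFun (Ω t) x ∧ radialFun (Ω t) x ≤ C₀) ∧
      ‖gradient (suppFun (Ω t)) x - suppFun (Ω t) x • x‖ ≤ C₀ ∧
      (1 / C₀ ≤ ‖gradient (u t) (gradient (suppFun (Ω t)) x)‖ ∧
        ‖gradient (u t) (gradient (suppFun (Ω t)) x)‖ ≤ C₀))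
    (heta : ∀ t ∈ Set.Ico (0 : ℝ) T,
      1 / C₀ ≤ etaFn n k p Ω u f t ∧ etaFn n k p Ω u f t ≤ C₀)
    (hD2u : ∀ t ∈ Set.Ico (0 : ℝ) T, ∀ y ∈ Ω t, ‖iteratedFDeriv ℝ 2 (u t) y‖ ≤ C₀)
    (hsigma : ∀ t ∈ Set.Ico (0 : ℝ) T, ∀ x : En n, ‖x‖ = 1 →
      1 / C₀ ≤ esym n (n - k) (hessMat (suppFun (Ω t)) x) ∧
        esym n (n - k) (hessMat (suppFun (Ω t)) x) ≤ C₀)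
    :
    ∃ C > (0 : ℝ), ∀ t ∈ Set.Ico (0 : ℝ) T, ∀ x : En n, ‖x‖ = 1 → ∀ ξ : En n,
      ⟪ξ, x⟫ = 0 →
      C⁻¹ * ‖ξ‖ ^ 2 ≤ quadForm (hessMat (suppFun (Ω t)) x) ξ ∧
        quadForm (hessMat (suppFun (Ω t)) x) ξ ≤ C * ‖ξ‖ ^ 2 := by
  have ha : (0 : ℝ) < 1 / C₀ / C₀ := by positivity
  refine ⟨(1 / C₀ / C₀)⁻¹ + C₀ / (1 / C₀ / C₀) ^ (n - k - 1), by positivity, ?_⟩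
  intro t ht x hx ξ hξ
  have hΩ := hflow.bodies t ht
  have hu := hflow.adm t ht
  have hx0 : x ≠ 0 := norm_ne_zero_iff.mp (hx ▸ one_ne_zero)
  have hmem := (gradient_suppFun_mem hΩ.body.comp hΩ.nonempty (hΩ.differentiableAt hx0)).1
  have hsq : ∀ v : En n, 1 / C₀ / C₀ * quadForm (hessMat (suppFun (Ω t)) x) v ≤
      ‖Matrix.toEuclideanLin (hessMat (suppFun (Ω t)) x) v‖ ^ 2 := by
    intro v
    have h := hΩ.mul_quadForm_le_norm_sq (hu.smooth.of_le (WithTop.coe_le_coe.mpr (le_top : (2 : ℕ∞) ≤ ⊤))) hu.bd hx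
      (hbnd t ht x hx).2.2.2.1 (hD2u t ht _ hmem) v
    rw [div_mul_eq_mul_div, div_le_iff₀ hC₀, mul_comm _ C₀]
    exact h
  obtain ⟨hlow, hup⟩ := quadForm_bounds_of_le_sq (isHermitian_hessMat (hΩ.contDiffAt hx0)) hx
    (hΩ.toEuclideanLin_hessMat_self hx0) (hΩ.strictConv x hx) ha hsq (m := n - k) (by omega)
    (by omega) (hsigma t ht x hx).2 hξ
  constructor
  · refine le_trans (mul_le_mul_of_nonneg_right ?_ (sq_nonneg _)) hlow
    exact inv_le_of_inv_le₀ ha (le_add_of_nonneg_right (by positivity))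
  · refine hup.trans (mul_le_mul_of_nonneg_right ?_ (sq_nonneg _))
    exact le_add_of_nonneg_left (by positivity)
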